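/- Fix a natural number l ≥ 1, a natural number y ≥ l, and a real p with 0 < p < 1. Then the l-fold convolution of the logarithmic(p) pmf at y equals the sum-logarithmic pmf: Σ over all functions f : {1,…,l} → ℕ with f(i) ≥ 1 for all i and Σ_i f(i) = y of ∏_{i=1}^l [p^{f(i)} / (f(i)·(−log(1−p)))] equals c(y,l)·l!·p^y/(y!·(−log(1−p))^l). Equivalently, Σ over such f of ∏_i 1/f(i) = c(y,l)·l!/y!, where c(y,l) is the unsigned Stirling number of the first kind. (This identifies the distribution of a sum of l i.i.d. logarithmic random variables, the SumLog distribution appearing in the paper's Lemma 1.) -/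

import Mathlib

open Finset

/-- The unsigned Stirling number of the first kind `c(y, l)`: the coefficient of `X^l`
in the ascending factorial `X (X+1) ⋯ (X+y-1)`. -/
noncomputable def stirling1 (y l : ℕ) : ℕ := (ascPochhammer ℕ y).coeff l

noncomputable def logSer : PowerSeries ℝ := PowerSeries.mk (fun n => ((n : ℝ))⁻¹)

lemma logSer_coeff_pow (l y : ℕ) : PowerSeries.coeff y (logSer ^ l) =
    ∑ f ∈ Finset.Nat.antidiagonalTuple l y, ∏ i, ((f i : ℝ))⁻¹ := by
  have h : logSer ^ l = ∏ _i : Fin l, logSer := by simp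
  rw [h, PowerSeries.coeff_prod]
  refine Finset.sum_nbij' (fun f => (f : Fin l → ℕ)) (fun f => Finsupp.equivFunOnFinite.symm f)
    ?_ ?_ ?_ ?_ ?_
  · intro f hf
    rw [Finset.mem_finsuppAntidiag] at hf
    rw [Finset.Nat.mem_antidiagonalTuple]
    exact hf.1
  · intro f hf
    rw [Finset.Nat.mem_antidiagonalTuple] at hf
    rw [Finset.mem_finsuppAntidiag]
    exact ⟨by simpa using hf, Finset.subset_univ _⟩
  · intro f _
    ext i
    simp
  · intro f _
    ext i
    simp
  · intro f _
    simp [logSer]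

lemma logSer_deriv : PowerSeries.derivative ℝ logSer * (1 - PowerSeries.X) = 1 := by
  have : PowerSeries.derivative ℝ logSer = PowerSeries.mk 1 := by
    ext n
    rw [PowerSeries.coeff_derivative]
    simp only [logSer, PowerSeries.coeff_mk, Pi.one_apply]
    push_cast
    exact inv_mul_cancel₀ (by positivity)
  rw [this, PowerSeries.mk_one_mul_one_sub_eq_one]

lemma logSer_rec (n l : ℕ) :
    PowerSeries.coeff (n + 1) (logSer ^ (l + 1)) * ((n : ℝ) + 1) =
      PowerSeries.coeff n (logSer ^ (l + 1)) * n +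
        ((l : ℝ) + 1) * PowerSeries.coeff n (logSer ^ l) := by
  have h : PowerSeries.derivative ℝ (logSer ^ (l + 1)) =
      PowerSeries.derivative ℝ (logSer ^ (l + 1)) * PowerSeries.X +
        PowerSeries.C ((l : ℝ) + 1) * logSer ^ l := by
    have h1 : PowerSeries.derivative ℝ (logSer ^ (l + 1)) =
        PowerSeries.C ((l : ℝ) + 1) * logSer ^ l * PowerSeries.derivative ℝ logSer := by
      rw [Derivation.leibniz_pow]
      simp [mul_assoc, nsmul_eq_mul]
    rw [h1]
    linear_combination (PowerSeries.C ((l : ℝ) + 1) * logSer ^ l) * logSer_deriv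
  have h2 := congrArg (PowerSeries.coeff n) h
  rw [map_add, PowerSeries.coeff_C_mul, PowerSeries.coeff_derivative] at h2
  rw [h2]
  congr 1
  cases n with
  | zero => simp
  | succ m =>
    rw [PowerSeries.coeff_succ_mul_X, PowerSeries.coeff_derivative]
    push_cast
    rfl

lemma stirling1_succ (n l : ℕ) :
    stirling1 (n + 1) (l + 1) = stirling1 n l + n * stirling1 n (l + 1) := by
  unfold stirling1
  rw [ascPochhammer_succ_right, mul_add, Polynomial.coeff_add, Polynomial.coeff_mul_X,
    Polynomial.coeff_mul_natCast, mul_comm n]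
  rfl

lemma stirling1_succ_zero (n : ℕ) : stirling1 (n + 1) 0 = 0 := by
  unfold stirling1
  rw [Polynomial.coeff_zero_eq_eval_zero]
  simp

lemma logSer_coeff (n : ℕ) : ∀ l : ℕ, PowerSeries.coeff n (logSer ^ l) * (n.factorial : ℝ) =
    (stirling1 n l : ℝ) * (l.factorial : ℝ) := by
  induction n with
  | zero =>
    intro l
    cases l with
    | zero => simp [stirling1]
    | succ k => simp [stirling1, logSer, Polynomial.coeff_one]
  | succ n ih =>
    intro l
    cases l with
    | zero => simp [stirling1_succ_zero, PowerSeries.coeff_one]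
    | succ k =>
      have h1 := ih k
      have h2 := ih (k + 1)
      have h3 := logSer_rec n k
      rw [stirling1_succ]
      rw [Nat.factorial_succ k] at h2 ⊢
      rw [Nat.factorial_succ n]
      push_cast at *
      linear_combination (n.factorial : ℝ) * h3 + n * h2 + (k + 1) * h1

/-- The `l`-fold convolution of the logarithmic(p) pmf at `y` equals the sum-logarithmic pmf
`SumLog(y; l, p) = c(y,l)·l!·p^y/(y!·(−log(1−p))^l)`. -/
theorem stmt_11 (l : ℕ) (hl : 1 ≤ l) (y : ℕ) (hy : l ≤ y) (p : ℝ)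
    (hp0 : 0 < p) (hp1 : p < 1) :
    ∑ f ∈ (Finset.Nat.antidiagonalTuple l y).filter (fun f => ∀ i, 1 ≤ f i),
        ∏ i, p ^ f i / ((f i : ℝ) * (-Real.log (1 - p))) =
      (stirling1 y l : ℝ) * (Nat.factorial l : ℝ) * p ^ y /
        ((Nat.factorial y : ℝ) * (-Real.log (1 - p)) ^ l) := by
  have hL : -Real.log (1 - p) ≠ 0 := by
    have := Real.log_neg (x := 1 - p) (by linarith) (by linarith)
    linarith
  rw [Finset.sum_filter_of_ne]
  · have key := logSer_coeff y l
    rw [logSer_coeff_pow] at key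
    have hfac : (y.factorial : ℝ) ≠ 0 := by positivity
    have : ∀ f ∈ Finset.Nat.antidiagonalTuple l y,
        ∏ i, p ^ f i / ((f i : ℝ) * (-Real.log (1 - p))) =
          (∏ i, ((f i : ℝ))⁻¹) * (p ^ y / (-Real.log (1 - p)) ^ l) := by
      intro f hf
      rw [Finset.Nat.mem_antidiagonalTuple] at hf
      rw [Finset.prod_div_distrib, Finset.prod_mul_distrib, Finset.prod_pow_eq_pow_sum, hf,
        Finset.prod_const, Finset.prod_inv_distrib, Finset.card_univ, Fintype.card_fin]
      rw [div_eq_mul_inv, mul_inv, div_eq_mul_inv]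
      ring
    rw [Finset.sum_congr rfl this, ← Finset.sum_mul, ← key]
    generalize -Real.log (1 - p) = L at *
    field_simp
  · intro f _ hne i
    by_contra hi
    apply hne
    apply Finset.prod_eq_zero (Finset.mem_univ i)
    have : f i = 0 := by omega
    simp [this]
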